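/- For every nonnegative integer p and every real number t with 0 ≤ t < 1, the series ∑_{k=0}^∞ [(k+p)!/k!]·H_{k+p}·t^k converges and equals p!·[H_p − ln(1−t)]/(1−t)^{p+1}. -/

import Mathlib

/-- The `k`-th harmonic number `H_k = ∑_{j=1}^k 1/j`, with `H_0 = 0`. -/
noncomputable def H (k : ℕ) : ℝ := ∑ j ∈ Finset.range k, (1 : ℝ) / (j + 1)

lemma H_zero : H 0 = 0 := by simp [H]

lemma H_succ (k : ℕ) : H (k + 1) = H k + 1 / ((k : ℝ) + 1) := by
  simp [H, Finset.sum_range_succ]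

/-- If `∑ b k * t ^ k` converges absolutely to `S`, the generating series of the partial sums of `b`
converges to `S / (1 - t)`. -/
lemma hasSum_partialSum_mul_pow {b : ℕ → ℝ} {t S : ℝ} (ht : |t| < 1)
    (hb : HasSum (fun k => b k * t ^ k) S) :
    HasSum (fun k => (∑ i ∈ Finset.range (k + 1), b i) * t ^ k) (S / (1 - t)) := by
  have hg := hasSum_geometric_of_abs_lt_one ht
  have h := hasSum_sum_range_mul_of_summable_norm hb.summable.norm hg.summable.norm
  rw [hb.tsum_eq, hg.tsum_eq, ← div_eq_mul_inv] at h
  refine h.congr_fun fun k => ?_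
  rw [Finset.sum_mul]
  refine Finset.sum_congr rfl fun i hi => ?_
  rw [mul_assoc, ← pow_add, Nat.add_sub_cancel' (Finset.mem_range_succ_iff.mp hi)]

lemma sum_choose_mul_H_add (p k : ℕ) :
    ∑ i ∈ Finset.range (k + 1),
        (((i + p).choose p : ℝ) * H (i + p) + ((i + p).choose p : ℝ) * (1 / ((p : ℝ) + 1))) =
      ((k + (p + 1)).choose (p + 1) : ℝ) * H (k + (p + 1)) := by
  induction k with
  | zero => simp [H_succ]
  | succ k ih =>
    have hpascal : ((k + 1 + (p + 1)).choose (p + 1) : ℝ) =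
        ((k + 1 + p).choose p : ℝ) + ((k + (p + 1)).choose (p + 1) : ℝ) := by
      rw [show k + (p + 1) = k + 1 + p by ring]
      exact_mod_cast Nat.choose_succ_succ (k + 1 + p) p
    have habsorb : (((k + 1 + p : ℕ) : ℝ) + 1) * ((k + 1 + p).choose p : ℝ) =
        ((k + 1 + (p + 1)).choose (p + 1) : ℝ) * ((p : ℝ) + 1) := by
      exact_mod_cast Nat.add_one_mul_choose_eq (k + 1 + p) p
    have hH : H (k + 1 + (p + 1)) = H (k + 1 + p) + 1 / (((k + 1 + p : ℕ) : ℝ) + 1) :=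
      H_succ (k + 1 + p)
    have hdiv : ((k + 1 + p).choose p : ℝ) * (1 / ((p : ℝ) + 1)) =
        ((k + 1 + (p + 1)).choose (p + 1) : ℝ) * (1 / (((k + 1 + p : ℕ) : ℝ) + 1)) := by
      field_simp
      linarith
    rw [Finset.sum_range_succ, ih, hdiv, hH, show H (k + (p + 1)) = H (k + 1 + p) by ring_nf,
      mul_add, hpascal]
    ring

lemma hasSum_H_mul_pow {t : ℝ} (ht : |t| < 1) :
    HasSum (fun k : ℕ => H k * t ^ k) (-Real.log (1 - t) / (1 - t)) := by
  have hlog : HasSum (fun k : ℕ => (1 / (k : ℝ)) * t ^ k) (-Real.log (1 - t)) := by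
    rw [← hasSum_nat_add_iff' 1]
    simpa [div_eq_inv_mul] using Real.hasSum_pow_div_log_of_abs_lt_one ht
  refine (hasSum_partialSum_mul_pow ht hlog).congr_fun fun k => ?_
  simp [H, Finset.sum_range_succ']

lemma hasSum_choose_mul_H_mul_pow (p : ℕ) {t : ℝ} (ht : |t| < 1) :
    HasSum (fun k : ℕ => ((k + p).choose p : ℝ) * H (k + p) * t ^ k)
      ((H p - Real.log (1 - t)) / (1 - t) ^ (p + 1)) := by
  induction p with
  | zero => simpa [H_zero] using hasSum_H_mul_pow ht
  | succ p ih =>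
    have hne : 1 - t ≠ 0 := by linarith [(abs_lt.mp ht).2]
    have hc := (hasSum_choose_mul_geometric_of_norm_lt_one p ht).mul_right (1 / ((p : ℝ) + 1))
    have h := hasSum_partialSum_mul_pow
      (b := fun i => ((i + p).choose p : ℝ) * H (i + p) +
        ((i + p).choose p : ℝ) * (1 / ((p : ℝ) + 1))) ht
      ((ih.add hc).congr_fun fun k => by ring)
    simp only [sum_choose_mul_H_add] at h
    convert! h using 1
    rw [H_succ]
    field_simp
    ring

theorem stmt_6 (p : ℕ) (t : ℝ) (ht0 : 0 ≤ t) (ht1 : t < 1) :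
    HasSum (fun k : ℕ => ((k + p).factorial : ℝ) / (k.factorial : ℝ) * H (k + p) * t ^ k)
      ((p.factorial : ℝ) * (H p - Real.log (1 - t)) / (1 - t) ^ (p + 1)) := by
  have ht : |t| < 1 := by rwa [abs_of_nonneg ht0]
  rw [mul_div_assoc]
  refine ((hasSum_choose_mul_H_mul_pow p ht).mul_left (p.factorial : ℝ)).congr_fun fun k => ?_
  rw [add_comm k p, Nat.cast_add_choose]
  field_simp
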